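/- For every integer k ≥ 2 there exists a constant C_k (depending only on k) such that for every smooth (C^∞) function f on the square K̂ = [−1,1]², the Q^k M-type projection remainder satisfies sup_{(s,t) ∈ K̂} |f(s,t) − f_{k,k}(s,t)| ≤ C_k [f]_{k+1}, where [f]_{k+1} = ( ∬_{K̂} (∂_s^{k+1} f)² ds dt + ∬_{K̂} (∂_t^{k+1} f)² ds dt )^{1/2}. -/

import Mathlib

open intervalIntegral

/-- The Legendre polynomial `l_j(t) = (1/(2^j j!)) (d/dt)^j (t²−1)^j`. -/
noncomputable def legendreP (j : ℕ) (t : ℝ) : ℝ :=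
  (1 / (2 ^ j * (Nat.factorial j : ℝ))) * iteratedDeriv j (fun x : ℝ => (x ^ 2 - 1) ^ j) t

/-- The M-type polynomials: `M_0(t) = 1`, `M_1(t) = t`, and
    `M_{k+1}(t) = (1/(2^k k!)) (d/dt)^{k−1} (t²−1)^k` for `k ≥ 1`. -/
noncomputable def Mpoly : ℕ → ℝ → ℝ
  | 0, _ => 1
  | 1, t => t
  | (k + 2), t =>
      (1 / (2 ^ (k + 1) * (Nat.factorial (k + 1) : ℝ))) *
        iteratedDeriv k (fun x : ℝ => (x ^ 2 - 1) ^ (k + 1)) t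

/-- The 2D M-type coefficients `b_{i,j}` of a function `f` on `[−1,1]²`. -/
noncomputable def mcoeff2 (f : ℝ → ℝ → ℝ) : ℕ → ℕ → ℝ
  | 0, 0 => (f (-1) (-1) + f (-1) 1 + f 1 (-1) + f 1 1) / 4
  | 0, (j + 1) => ((2 * ((j : ℝ) + 1) - 1) / 4) *
      ∫ t in (-1:ℝ)..1, (deriv (f 1) t + deriv (f (-1)) t) * legendreP j t
  | (i + 1), 0 => ((2 * ((i : ℝ) + 1) - 1) / 4) *
      ∫ s in (-1:ℝ)..1,
        (deriv (fun x => f x 1) s + deriv (fun x => f x (-1)) s) * legendreP i s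
  | (i + 1), (j + 1) => ((2 * ((i : ℝ) + 1) - 1) * (2 * ((j : ℝ) + 1) - 1) / 4) *
      ∫ s in (-1:ℝ)..1, ∫ t in (-1:ℝ)..1,
        deriv (fun x => deriv (f x) t) s * legendreP i s * legendreP j t

/-- The `Q^k` M-type projection `f_{k,k}(s,t) = Σ_{i=0}^{k} Σ_{j=0}^{k} b_{i,j} M_i(s) M_j(t)`. -/
noncomputable def mproj2 (f : ℝ → ℝ → ℝ) (k : ℕ) (s t : ℝ) : ℝ :=
  ∑ i ∈ Finset.range (k + 1), ∑ j ∈ Finset.range (k + 1),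
    mcoeff2 f i j * Mpoly i s * Mpoly j t

/-- The mixed partial derivative `∂_s^i ∂_t^j f (s,t)`. -/
noncomputable def pderiv2 (i j : ℕ) (f : ℝ → ℝ → ℝ) (s t : ℝ) : ℝ :=
  iteratedDeriv i (fun x => iteratedDeriv j (f x) t) s

/-- The seminorm `[f]_m = ( ∬ (∂_s^m f)² + ∬ (∂_t^m f)² )^{1/2}` on `[−1,1]²`. -/
noncomputable def seminorm2 (m : ℕ) (f : ℝ → ℝ → ℝ) : ℝ :=
  Real.sqrt ((∫ s in (-1:ℝ)..1, ∫ t in (-1:ℝ)..1, (pderiv2 m 0 f s t) ^ 2) +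
             (∫ s in (-1:ℝ)..1, ∫ t in (-1:ℝ)..1, (pderiv2 0 m f s t) ^ 2))

open Polynomial in
/-- Iterated derivatives of a polynomial function are given by iterated formal derivatives. -/
theorem iteratedDeriv_polynomial_eval (n : ℕ) (p : ℝ[X]) :
    iteratedDeriv n (fun x => p.eval x) = fun x => (derivative^[n] p).eval x := by
  induction n generalizing p with
  | zero => simp
  | succ n ih =>
    rw [iteratedDeriv_succ', Function.iterate_succ_apply, ← ih]
    congr 1
    funext x
    exact p.deriv

section LegendrePolynomials

open Polynomial

/-- The polynomial `(X² − 1)^n` of the Rodrigues formula. -/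
noncomputable def rodriguesBase (n : ℕ) : ℝ[X] := (X ^ 2 - 1) ^ n

/-- The Legendre polynomial as a formal polynomial. -/
noncomputable def legendrePoly (n : ℕ) : ℝ[X] :=
  C (1 / (2 ^ n * (Nat.factorial n : ℝ))) * derivative^[n] (rodriguesBase n)

/-- The M-type polynomial as a formal polynomial. -/
noncomputable def mPoly : ℕ → ℝ[X]
  | 0 => 1
  | 1 => X
  | (k + 2) => C (1 / (2 ^ (k + 1) * (Nat.factorial (k + 1) : ℝ))) *
      derivative^[k] (rodriguesBase (k + 1))

theorem mPoly_zero : mPoly 0 = 1 := rfl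

theorem legendreP_eq_eval (n : ℕ) : legendreP n = fun x => (legendrePoly n).eval x := by
  funext x
  have := congrFun (iteratedDeriv_polynomial_eval n (rodriguesBase n)) x
  simp only [rodriguesBase, eval_pow, eval_sub, eval_X, eval_one] at this
  simp [legendreP, legendrePoly, this, rodriguesBase]

theorem Mpoly_eq_eval (n : ℕ) : Mpoly n = fun x => (mPoly n).eval x := by
  funext x
  match n with
  | 0 => simp [Mpoly, mPoly]
  | 1 => simp [Mpoly, mPoly]
  | k + 2 =>
    have := congrFun (iteratedDeriv_polynomial_eval k (rodriguesBase (k + 1))) x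
    simp only [rodriguesBase, eval_pow, eval_sub, eval_X, eval_one] at this
    simp [Mpoly, mPoly, this, rodriguesBase]

theorem derivative_mPoly_succ (n : ℕ) : derivative (mPoly (n + 1)) = legendrePoly n := by
  match n with
  | 0 => simp [mPoly, legendrePoly, rodriguesBase]
  | k + 1 =>
    simp only [mPoly, legendrePoly, derivative_C_mul, Function.iterate_succ_apply']

theorem eval_iterate_derivative_rodriguesBase {j n : ℕ} (h : j < n) {x : ℝ} (hx : x ^ 2 = 1) :
    (derivative^[j] (rodriguesBase n)).eval x = 0 := by
  obtain ⟨c, hc⟩ := pow_sub_dvd_iterate_derivative_pow (X ^ 2 - 1 : ℝ[X]) n j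
  rw [rodriguesBase, hc]
  have : n - j ≠ 0 := by omega
  simp [hx, this]

theorem mPoly_eval_add_eval_neg_one (n : ℕ) :
    (mPoly (n + 1)).eval 1 + (mPoly (n + 1)).eval (-1) = 0 := by
  match n with
  | 0 => simp [mPoly]
  | k + 1 =>
    simp [mPoly, eval_iterate_derivative_rodriguesBase (Nat.lt_succ_self k)]

theorem integral_derivative_mul (p q : ℝ[X]) :
    ∫ x in (-1:ℝ)..1, (derivative p).eval x * q.eval x =
      p.eval 1 * q.eval 1 - p.eval (-1) * q.eval (-1)
        - ∫ x in (-1:ℝ)..1, p.eval x * (derivative q).eval x := by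
  have h := integral_mul_deriv_eq_deriv_mul (a := (-1:ℝ)) (b := 1)
    (fun x _ => p.hasDerivAt x) (fun x _ => q.hasDerivAt x)
    (derivative p).continuous.continuousOn.intervalIntegrable
    (derivative q).continuous.continuousOn.intervalIntegrable
  linarith

theorem integral_rodrigues_mul_eq_zero {n j : ℕ} (hj : j ≤ n) (q : ℝ[X])
    (hq : derivative^[j] q = 0) :
    ∫ x in (-1:ℝ)..1, (derivative^[j] (rodriguesBase n)).eval x * q.eval x = 0 := by
  induction j generalizing q with
  | zero =>
    have : q = 0 := hq
    simp [this]
  | succ j ih =>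
    rw [Function.iterate_succ_apply', integral_derivative_mul, ih (by omega) _ hq,
      eval_iterate_derivative_rodriguesBase (by omega) (by norm_num),
      eval_iterate_derivative_rodriguesBase (by omega) (by norm_num)]
    simp

theorem integral_legendrePoly_mul_eq_zero {n : ℕ} (q : ℝ[X]) (hq : derivative^[n] q = 0) :
    ∫ x in (-1:ℝ)..1, (legendrePoly n).eval x * q.eval x = 0 := by
  simp only [legendrePoly, eval_mul, eval_C, mul_assoc, intervalIntegral.integral_const_mul]
  rw [integral_rodrigues_mul_eq_zero le_rfl q hq, mul_zero]

theorem iterate_derivative_legendrePoly_eq_zero {n m : ℕ} (h : n < m) :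
    derivative^[m] (legendrePoly n) = 0 := by
  rw [legendrePoly, iterate_derivative_C_mul, ← Function.iterate_add_apply,
    iterate_derivative_eq_zero, mul_zero]
  have : (rodriguesBase n).natDegree ≤ n * 2 := by
    refine natDegree_pow_le.trans (Nat.mul_le_mul_left _ ?_)
    compute_degree
  omega

theorem legendrePoly_eval_sq {n : ℕ} {x : ℝ} (hx : x ^ 2 = 1) : (legendrePoly n).eval x ^ 2 = 1 := by
  have h : rodriguesBase n = (X - C x) ^ n * (X + C x) ^ n := by
    rw [rodriguesBase, ← mul_pow, ← C_1, ← hx, C_pow]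
    congr 1
    ring
  have := aeval_iterate_derivative_self (rodriguesBase n) n x (p' := (X + C x) ^ n) (by simp [h])
  have hx0 : x ≠ 0 := by rintro rfl; norm_num at hx
  simp only [coe_aeval_eq_eval] at this
  rw [legendrePoly, eval_mul, eval_C, this]
  have h2 : (x + x) ^ n = 2 ^ n * x ^ n := by rw [← two_mul, mul_pow]
  simp only [eval_pow, eval_add, eval_X, eval_C, nsmul_eq_mul, h2]
  field_simp
  rw [← pow_mul, mul_comm, pow_mul, hx, one_pow]

theorem integral_legendrePoly_sq (n : ℕ) :
    (2 * (n : ℝ) + 1) * ∫ x in (-1:ℝ)..1, (legendrePoly n).eval x * (legendrePoly n).eval x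
      = 2 := by
  set l := legendrePoly n with hl
  have h1 := integral_derivative_mul X (l * l)
  have h2 : ∫ x in (-1:ℝ)..1, l.eval x * (derivative l * X - C (n : ℝ) * l).eval x = 0 := by
    apply integral_legendrePoly_mul_eq_zero
    rw [iterate_derivative_sub, iterate_derivative_C_mul, iterate_derivative_derivative_mul_X, hl,
      iterate_derivative_legendrePoly_eq_zero (Nat.lt_succ_self n)]
    simp
  have e1 : l.eval 1 ^ 2 = 1 := legendrePoly_eval_sq (by norm_num)
  have e2 : l.eval (-1) ^ 2 = 1 := legendrePoly_eval_sq (by norm_num)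
  have h3 : ∫ x in (-1:ℝ)..1, l.eval x * (derivative l * X - C (n : ℝ) * l).eval x
      = (∫ x in (-1:ℝ)..1, (X * derivative (l * l)).eval x) / 2
        - n * ∫ x in (-1:ℝ)..1, l.eval x * l.eval x := by
    rw [← intervalIntegral.integral_div, ← intervalIntegral.integral_const_mul,
      ← intervalIntegral.integral_sub]
    · refine intervalIntegral.integral_congr fun x _ => ?_
      simp only [eval_sub, eval_mul, eval_X, eval_C, derivative_mul, eval_add]
      ring
    all_goals exact Continuous.intervalIntegrable (by fun_prop) _ _
  simp only [derivative_X, eval_one, one_mul, eval_mul, eval_X] at h1 h3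
  rw [h2] at h3
  nlinarith

/-- A polynomial whose `K`-th derivative vanishes equals its Legendre expansion of length `K`. -/
theorem sum_legendrePoly_eq (K : ℕ) (q : ℝ[X]) (hq : derivative^[K] q = 0) (x : ℝ) :
    ∑ n ∈ Finset.range K, (2 * (n : ℝ) + 1) / 2 *
      (∫ y in (-1:ℝ)..1, q.eval y * (legendrePoly n).eval y) * (legendrePoly n).eval x
      = q.eval x := by
  induction K generalizing q with
  | zero =>
    have : q = 0 := hq
    simp [this]
  | succ K ih =>
    have hconst : ∀ p : ℝ[X], derivative^[K + 1] p = 0 → ∃ a, derivative^[K] p = C a := by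
      intro p hp
      rw [Function.iterate_succ_apply'] at hp
      exact ⟨_, eq_C_of_natDegree_eq_zero (derivative_eq_zero.1 hp)⟩
    obtain ⟨a, ha⟩ := hconst q hq
    obtain ⟨b, hb⟩ := hconst (legendrePoly K)
      (iterate_derivative_legendrePoly_eq_zero (Nat.lt_succ_self K))
    have hnorm := integral_legendrePoly_sq K
    have hb0 : b ≠ 0 := by
      rintro rfl
      rw [integral_legendrePoly_mul_eq_zero _ (by simpa using hb)] at hnorm
      norm_num at hnorm
    set c := a / b
    have hr : derivative^[K] (q - C c * legendrePoly K) = 0 := by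
      rw [iterate_derivative_sub, iterate_derivative_C_mul, ha, hb, ← C_mul, div_mul_cancel₀ _ hb0,
        sub_self]
    have horth : ∀ n, ∫ y in (-1:ℝ)..1, (q - C c * legendrePoly K).eval y * (legendrePoly n).eval y
        = (∫ y in (-1:ℝ)..1, q.eval y * (legendrePoly n).eval y)
          - c * ∫ y in (-1:ℝ)..1, (legendrePoly K).eval y * (legendrePoly n).eval y := by
      intro n
      rw [← intervalIntegral.integral_const_mul, ← intervalIntegral.integral_sub]
      · refine intervalIntegral.integral_congr fun x _ => ?_
        simp only [eval_sub, eval_mul, eval_C]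
        ring
      all_goals exact Continuous.intervalIntegrable (by fun_prop) _ _
    have hlow := ih _ hr
    rw [Finset.sum_range_succ]
    have htop : ∫ y in (-1:ℝ)..1, q.eval y * (legendrePoly K).eval y
        = c * ∫ y in (-1:ℝ)..1, (legendrePoly K).eval y * (legendrePoly K).eval y := by
      have h0 := integral_legendrePoly_mul_eq_zero _ hr
      simp only [mul_comm ((legendrePoly K).eval _)] at h0
      rw [horth K] at h0
      linarith
    have hsum : ∑ n ∈ Finset.range K, (2 * (n : ℝ) + 1) / 2 *
        (∫ y in (-1:ℝ)..1, q.eval y * (legendrePoly n).eval y) * (legendrePoly n).eval x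
        = q.eval x - c * (legendrePoly K).eval x := by
      rw [eval_sub, eval_mul, eval_C] at hlow
      rw [← hlow]
      refine Finset.sum_congr rfl fun n hn => ?_
      rw [horth n, integral_legendrePoly_mul_eq_zero (n := K) (legendrePoly n)
        (iterate_derivative_legendrePoly_eq_zero (Finset.mem_range.1 hn))]
      ring
    rw [hsum, htop]
    linear_combination (c * (legendrePoly K).eval x / 2) * hnorm

end LegendrePolynomials

section PartialDerivatives

theorem contDiff_deriv_right {f : ℝ → ℝ → ℝ} (hf : ContDiff ℝ (⊤ : ℕ∞) (Function.uncurry f)) :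
    ContDiff ℝ (⊤ : ℕ∞) (Function.uncurry fun s t => deriv (f s) t) := by
  have h : ContDiff ℝ (⊤ : ℕ∞) (Function.uncurry fun (p : ℝ × ℝ) y => f p.1 y) :=
    hf.comp ((contDiff_fst.comp contDiff_fst).prodMk contDiff_snd)
  exact ContDiff.fderiv_apply (n := (⊤ : ℕ∞)) h contDiff_snd (contDiff_const (c := (1 : ℝ)))
    (by exact_mod_cast le_refl _)

theorem contDiff_uncurry_swap {f : ℝ → ℝ → ℝ}
    (hf : ContDiff ℝ (⊤ : ℕ∞) (Function.uncurry f)) :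
    ContDiff ℝ (⊤ : ℕ∞) (Function.uncurry fun s t => f t s) :=
  hf.comp (contDiff_snd.prodMk contDiff_fst)

theorem contDiff_deriv_left {f : ℝ → ℝ → ℝ} (hf : ContDiff ℝ (⊤ : ℕ∞) (Function.uncurry f)) :
    ContDiff ℝ (⊤ : ℕ∞) (Function.uncurry fun s t => deriv (fun x => f x t) s) :=
  contDiff_uncurry_swap (contDiff_deriv_right (contDiff_uncurry_swap hf))

theorem contDiff_iteratedDeriv_right {f : ℝ → ℝ → ℝ}
    (hf : ContDiff ℝ (⊤ : ℕ∞) (Function.uncurry f)) (m : ℕ) :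
    ContDiff ℝ (⊤ : ℕ∞) (Function.uncurry fun s t => iteratedDeriv m (f s) t) := by
  induction m with
  | zero => simpa using hf
  | succ m ih => simpa only [iteratedDeriv_succ] using contDiff_deriv_right ih

theorem contDiff_section_right {f : ℝ → ℝ → ℝ}
    (hf : ContDiff ℝ (⊤ : ℕ∞) (Function.uncurry f)) (s : ℝ) : ContDiff ℝ (⊤ : ℕ∞) (f s) :=
  hf.comp (contDiff_const.prodMk contDiff_id)

theorem contDiff_section_left {f : ℝ → ℝ → ℝ}
    (hf : ContDiff ℝ (⊤ : ℕ∞) (Function.uncurry f)) (t : ℝ) :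
    ContDiff ℝ (⊤ : ℕ∞) (fun s => f s t) :=
  hf.comp (contDiff_id.prodMk contDiff_const)

theorem integral_swap_of_continuous {F : ℝ → ℝ → ℝ} (hF : Continuous (Function.uncurry F))
    (a b c d : ℝ) : ∫ x in a..b, ∫ y in c..d, F x y = ∫ y in c..d, ∫ x in a..b, F x y := by
  refine MeasureTheory.intervalIntegral_intervalIntegral_swap ?_
  exact (hF.continuousOn.integrableOn_compact
    (isCompact_uIcc.prod isCompact_uIcc)).mono_set
      (Set.prod_mono Set.uIoc_subset_uIcc Set.uIoc_subset_uIcc)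

theorem continuous_uncurry_swap {F : ℝ → ℝ → ℝ} (hF : Continuous (Function.uncurry F)) :
    Continuous (Function.uncurry fun s t => F t s) := hF.comp continuous_swap

theorem continuous_section_right {F : ℝ → ℝ → ℝ} (hF : Continuous (Function.uncurry F)) (s : ℝ) :
    Continuous (F s) := hF.comp (continuous_const.prodMk continuous_id)

theorem continuous_section_left {F : ℝ → ℝ → ℝ} (hF : Continuous (Function.uncurry F)) (t : ℝ) :
    Continuous (fun s => F s t) := hF.comp (continuous_id.prodMk continuous_const)

end PartialDerivatives

section MTypeFunctionals

open Polynomial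

/-- The one-dimensional M-type coefficient functionals, with the derivative moved onto the Legendre
polynomial so that they are defined for merely continuous functions. -/
noncomputable def mcoeff : ℕ → (ℝ → ℝ) → ℝ
  | 0, g => (g 1 + g (-1)) / 2
  | j + 1, g => (2 * (j : ℝ) + 1) / 2 *
      (g 1 * (legendrePoly j).eval 1 - g (-1) * (legendrePoly j).eval (-1)
        - ∫ y in (-1:ℝ)..1, g y * (derivative (legendrePoly j)).eval y)

theorem mcoeff_succ_eq_integral_deriv (j : ℕ) {g : ℝ → ℝ} (hg : ContDiff ℝ (⊤ : ℕ∞) g) :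
    mcoeff (j + 1) g = (2 * (j : ℝ) + 1) / 2 *
      ∫ y in (-1:ℝ)..1, deriv g y * (legendrePoly j).eval y := by
  have hc : Continuous (deriv g) := hg.continuous_deriv (by exact_mod_cast le_top)
  have hd : Differentiable ℝ g := hg.differentiable (by simp)
  have h := intervalIntegral.integral_mul_deriv_eq_deriv_mul (a := (-1:ℝ)) (b := 1)
    (fun x _ => (hd x).hasDerivAt) (fun x _ => (legendrePoly j).hasDerivAt x)
    hc.continuousOn.intervalIntegrable
    (derivative (legendrePoly j)).continuous.continuousOn.intervalIntegrable
  rw [mcoeff, h]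
  ring

theorem mcoeff_sub (j : ℕ) {g h : ℝ → ℝ} (hg : Continuous g) (hh : Continuous h) :
    mcoeff j (fun x => g x - h x) = mcoeff j g - mcoeff j h := by
  match j with
  | 0 => simp only [mcoeff]; ring
  | j + 1 =>
    simp only [mcoeff, sub_mul]
    rw [intervalIntegral.integral_sub]
    · ring
    all_goals exact Continuous.intervalIntegrable (by fun_prop) _ _

theorem mcoeff_sum {ι : Type*} (j : ℕ) (S : Finset ι) {g : ι → ℝ → ℝ} (c : ι → ℝ)
    (hg : ∀ i, Continuous (g i)) :
    mcoeff j (fun x => ∑ i ∈ S, g i x * c i) = ∑ i ∈ S, mcoeff j (g i) * c i := by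
  match j with
  | 0 =>
    simp only [mcoeff, ← Finset.sum_add_distrib, Finset.sum_div]
    exact Finset.sum_congr rfl fun i _ => by ring
  | j + 1 =>
    simp only [mcoeff, Finset.sum_mul]
    rw [intervalIntegral.integral_finsetSum]
    · rw [← Finset.sum_sub_distrib, ← Finset.sum_sub_distrib, Finset.mul_sum]
      refine Finset.sum_congr rfl fun i _ => ?_
      simp only [mul_right_comm _ (c i), intervalIntegral.integral_mul_const]
      ring
    · intro i _
      have := hg i
      exact Continuous.intervalIntegrable (by fun_prop) _ _

theorem exists_abs_eval_le (p : ℝ[X]) :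
    ∃ C, 0 ≤ C ∧ ∀ x ∈ Set.Icc (-1:ℝ) 1, |p.eval x| ≤ C := by
  obtain ⟨C, hC⟩ := isCompact_Icc.exists_bound_of_continuousOn (s := Set.Icc (-1:ℝ) 1)
    p.continuous.continuousOn
  exact ⟨C, (norm_nonneg _).trans (hC 0 (by norm_num)), hC⟩

theorem abs_integral_le_of_abs_le {g : ℝ → ℝ} {b : ℝ}
    (h : ∀ x ∈ Set.Icc (-1:ℝ) 1, |g x| ≤ b) : |∫ x in (-1:ℝ)..1, g x| ≤ 2 * b := by
  have := intervalIntegral.norm_integral_le_of_norm_le_const (a := (-1:ℝ)) (b := 1) (f := g)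
    (C := b) (fun x hx => by
      rw [Set.uIoc_of_le (by norm_num)] at hx
      exact h x ⟨hx.1.le, hx.2⟩)
  rw [Real.norm_eq_abs] at this
  norm_num at this
  linarith

theorem exists_abs_mcoeff_le (j : ℕ) : ∃ C, 0 ≤ C ∧ ∀ (g : ℝ → ℝ) (b : ℝ),
    (∀ x ∈ Set.Icc (-1:ℝ) 1, |g x| ≤ b) → |mcoeff j g| ≤ C * b := by
  match j with
  | 0 =>
    refine ⟨1, zero_le_one, fun g b h => ?_⟩
    have h1 := abs_le.1 (h 1 (by norm_num))
    have h2 := abs_le.1 (h (-1) (by norm_num))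
    rw [mcoeff, abs_le]
    constructor <;> linarith
  | j + 1 =>
    obtain ⟨A, hA0, hA⟩ := exists_abs_eval_le (legendrePoly j)
    obtain ⟨D, hD0, hD⟩ := exists_abs_eval_le (derivative (legendrePoly j))
    refine ⟨(2 * (j : ℝ) + 1) / 2 * (A + A + 2 * D), by positivity, fun g b h => ?_⟩
    have hb : 0 ≤ b := (abs_nonneg _).trans (h 0 (by norm_num))
    have h1 : |g 1 * (legendrePoly j).eval 1| ≤ b * A := by
      rw [abs_mul]
      exact mul_le_mul (h 1 (by norm_num)) (hA 1 (by norm_num)) (abs_nonneg _) hb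
    have h2 : |g (-1) * (legendrePoly j).eval (-1)| ≤ b * A := by
      rw [abs_mul]
      exact mul_le_mul (h (-1) (by norm_num)) (hA (-1) (by norm_num)) (abs_nonneg _) hb
    have h3 : |∫ y in (-1:ℝ)..1, g y * (derivative (legendrePoly j)).eval y| ≤ 2 * (b * D) := by
      refine abs_integral_le_of_abs_le fun x hx => ?_
      rw [abs_mul]
      exact mul_le_mul (h x hx) (hD x hx) (abs_nonneg _) hb
    rw [mcoeff, abs_mul, abs_of_nonneg (by positivity), mul_assoc]
    refine mul_le_mul_of_nonneg_left ?_ (by positivity)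
    refine (abs_sub _ _).trans ?_
    have := abs_sub (g 1 * (legendrePoly j).eval 1) (g (-1) * (legendrePoly j).eval (-1))
    linarith

theorem continuous_mcoeff (j : ℕ) {F : ℝ → ℝ → ℝ} (hF : Continuous (Function.uncurry F)) :
    Continuous fun s => mcoeff j (F s) := by
  have h1 := continuous_section_left hF 1
  have h2 := continuous_section_left hF (-1)
  match j with
  | 0 =>
    simp only [mcoeff]
    fun_prop
  | j + 1 =>
    simp only [mcoeff]
    have h3 : Continuous fun s => ∫ y in (-1:ℝ)..1,
        F s y * (derivative (legendrePoly j)).eval y := by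
      apply intervalIntegral.continuous_parametric_intervalIntegral_of_continuous'
      exact hF.mul ((derivative (legendrePoly j)).continuous.comp continuous_snd)
    fun_prop

/-- The Fubini theorem for a coefficient functional and a weighted integral. -/
theorem integral_mcoeff_mul (i : ℕ) {F : ℝ → ℝ → ℝ} (hF : Continuous (Function.uncurry F))
    (p : ℝ[X]) :
    ∫ t in (-1:ℝ)..1, mcoeff i (fun s => F s t) * p.eval t =
      mcoeff i (fun s => ∫ t in (-1:ℝ)..1, F s t * p.eval t) := by
  have h1 := continuous_section_right hF 1
  have h2 := continuous_section_right hF (-1)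
  match i with
  | 0 =>
    simp only [mcoeff]
    rw [← intervalIntegral.integral_add, ← intervalIntegral.integral_div]
    · refine intervalIntegral.integral_congr fun x _ => ?_
      ring
    all_goals exact Continuous.intervalIntegrable (by fun_prop) _ _
  | i + 1 =>
    simp only [mcoeff]
    have hG : Continuous (Function.uncurry fun s t =>
        F s t * p.eval t * (derivative (legendrePoly i)).eval s) := by
      exact (hF.mul (p.continuous.comp continuous_snd)).mul
        ((derivative (legendrePoly i)).continuous.comp continuous_fst)
    have h3 : Continuous fun t => ∫ s in (-1:ℝ)..1,
        F s t * (derivative (legendrePoly i)).eval s := by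
      apply intervalIntegral.continuous_parametric_intervalIntegral_of_continuous'
      exact (hF.comp continuous_swap).mul
        ((derivative (legendrePoly i)).continuous.comp continuous_snd)
    have hsw : ∫ s in (-1:ℝ)..1, (∫ t in (-1:ℝ)..1, F s t * p.eval t) *
          (derivative (legendrePoly i)).eval s =
        ∫ t in (-1:ℝ)..1, (∫ s in (-1:ℝ)..1, F s t * (derivative (legendrePoly i)).eval s) *
          p.eval t := by
      simp only [← intervalIntegral.integral_mul_const]
      rw [integral_swap_of_continuous hG]
      refine intervalIntegral.integral_congr fun x _ => ?_
      refine intervalIntegral.integral_congr fun y _ => ?_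
      ring
    rw [hsw, ← intervalIntegral.integral_mul_const, ← intervalIntegral.integral_mul_const,
      ← intervalIntegral.integral_sub, ← intervalIntegral.integral_sub,
      ← intervalIntegral.integral_const_mul]
    · refine intervalIntegral.integral_congr fun x _ => ?_
      ring
    all_goals exact Continuous.intervalIntegrable (by fun_prop) _ _

theorem mcoeff2_eq_mcoeff_mcoeff {f : ℝ → ℝ → ℝ}
    (hf : ContDiff ℝ (⊤ : ℕ∞) (Function.uncurry f)) (i j : ℕ) :
    mcoeff2 f i j = mcoeff i (fun x => mcoeff j (f x)) := by
  have hr := fun s => contDiff_section_right hf s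
  have hl := fun t => contDiff_section_left hf t
  have hdr := contDiff_deriv_right hf
  have hdl := contDiff_deriv_left hf
  match i, j with
  | 0, 0 => simp only [mcoeff2, mcoeff]; ring
  | 0, j + 1 =>
    have c1 := (contDiff_section_right hdr 1).continuous
    have c2 := (contDiff_section_right hdr (-1)).continuous
    rw [mcoeff, mcoeff_succ_eq_integral_deriv j (hr 1), mcoeff_succ_eq_integral_deriv j (hr (-1)),
      mcoeff2, legendreP_eq_eval]
    simp only [add_mul]
    rw [intervalIntegral.integral_add]
    · ring
    all_goals exact Continuous.intervalIntegrable (by fun_prop) _ _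
  | i + 1, 0 =>
    have hsum : ContDiff ℝ (⊤ : ℕ∞) (fun x => (f x 1 + f x (-1)) / 2) :=
      ((hl 1).add (hl (-1))).div_const 2
    have hderiv : ∀ x, deriv (fun x => (f x 1 + f x (-1)) / 2) x =
        (deriv (fun x => f x 1) x + deriv (fun x => f x (-1)) x) / 2 := by
      intro x
      rw [deriv_div_const, deriv_fun_add]
      · exact ((hl 1).differentiable (by simp)) x
      · exact ((hl (-1)).differentiable (by simp)) x
    simp only [mcoeff.eq_1]
    rw [mcoeff_succ_eq_integral_deriv i hsum, mcoeff2, legendreP_eq_eval]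
    simp only [hderiv, div_mul_eq_mul_div, intervalIntegral.integral_div]
    ring
  | i + 1, j + 1 =>
    have hrl := contDiff_deriv_left hdr
    simp only [mcoeff_succ_eq_integral_deriv j (hr _)]
    have hscale : ∀ G : ℝ → ℝ, ∀ c : ℝ, mcoeff (i + 1) (fun x => c * G x) =
        c * mcoeff (i + 1) G := by
      intro G c
      simp only [mcoeff, mul_assoc, intervalIntegral.integral_const_mul]
      ring
    rw [hscale, ← integral_mcoeff_mul (i + 1) hdr.continuous]
    simp only [mcoeff_succ_eq_integral_deriv i (contDiff_section_left hdr _), mul_assoc,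
      intervalIntegral.integral_const_mul]
    rw [mcoeff2, legendreP_eq_eval, legendreP_eq_eval, integral_swap_of_continuous]
    · simp only [intervalIntegral.integral_mul_const]
      ring
    · exact (hrl.continuous.mul ((legendrePoly i).continuous.comp continuous_fst)).mul
        ((legendrePoly j).continuous.comp continuous_snd)

/-- The one-dimensional M-type projection onto the span of the first `K` M-type polynomials. -/
noncomputable def mproj (K : ℕ) (t : ℝ) (g : ℝ → ℝ) : ℝ :=
  ∑ j ∈ Finset.range K, mcoeff j g * (mPoly j).eval t

theorem mproj2_eq_mproj_mproj {f : ℝ → ℝ → ℝ}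
    (hf : ContDiff ℝ (⊤ : ℕ∞) (Function.uncurry f)) (k : ℕ) (s t : ℝ) :
    mproj2 f k s t = mproj (k + 1) s (fun x => mproj (k + 1) t (f x)) := by
  simp only [mproj2, mproj, mcoeff2_eq_mcoeff_mcoeff hf, Mpoly_eq_eval]
  refine Finset.sum_congr rfl fun i _ => ?_
  rw [mcoeff_sum i _ _ fun j => continuous_mcoeff j hf.continuous, Finset.sum_mul]
  exact Finset.sum_congr rfl fun j _ => by ring

theorem mproj_sub (K : ℕ) (t : ℝ) {g h : ℝ → ℝ} (hg : Continuous g) (hh : Continuous h) :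
    mproj K t (fun x => g x - h x) = mproj K t g - mproj K t h := by
  simp only [mproj, mcoeff_sub _ hg hh, sub_mul, Finset.sum_sub_distrib]

theorem continuous_mproj (K : ℕ) (t : ℝ) {F : ℝ → ℝ → ℝ} (hF : Continuous (Function.uncurry F)) :
    Continuous fun s => mproj K t (F s) :=
  continuous_finsetSum _ fun j _ => (continuous_mcoeff j hF).mul continuous_const

theorem exists_abs_mproj_le (K : ℕ) : ∃ C, 0 ≤ C ∧ ∀ t ∈ Set.Icc (-1:ℝ) 1, ∀ (g : ℝ → ℝ) (b : ℝ),
    (∀ x ∈ Set.Icc (-1:ℝ) 1, |g x| ≤ b) → |mproj K t g| ≤ C * b := by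
  choose A hA0 hA using exists_abs_mcoeff_le
  choose D hD0 hD using fun j => exists_abs_eval_le (mPoly j)
  refine ⟨∑ j ∈ Finset.range K, A j * D j,
    Finset.sum_nonneg fun j _ => mul_nonneg (hA0 j) (hD0 j), fun t ht g b h => ?_⟩
  have hb : 0 ≤ b := (abs_nonneg _).trans (h 0 (by norm_num))
  rw [mproj, Finset.sum_mul]
  refine (Finset.abs_sum_le_sum_abs _ _).trans (Finset.sum_le_sum fun j _ => ?_)
  rw [abs_mul, mul_right_comm]
  exact mul_le_mul (hA j g b h) (hD j t ht) (abs_nonneg _) (mul_nonneg (hA0 j) hb)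

/-- The M-type projection reproduces polynomials of degree less than `K`. -/
theorem mproj_eval {K : ℕ} (q : ℝ[X]) (hq : derivative^[K + 1] q = 0) (t : ℝ) :
    mproj (K + 1) t (fun x => q.eval x) = q.eval t := by
  set P : ℝ[X] := ∑ j ∈ Finset.range (K + 1), C (mcoeff j fun x => q.eval x) * mPoly j with hP
  have hPt : ∀ t, mproj (K + 1) t (fun x => q.eval x) = P.eval t := by
    intro t
    simp [mproj, hP, eval_finsetSum]
  have hcoeff : ∀ j, mcoeff (j + 1) (fun x => q.eval x) = (2 * (j : ℝ) + 1) / 2 *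
      ∫ y in (-1:ℝ)..1, (derivative q).eval y * (legendrePoly j).eval y := by
    intro j
    rw [mcoeff_succ_eq_integral_deriv j (by simpa using q.contDiff_aeval (𝕜 := ℝ) (⊤ : ℕ∞))]
    simp only [Polynomial.deriv]
  have hderiv : derivative P = derivative q := by
    refine Polynomial.funext fun x => ?_
    rw [← sum_legendrePoly_eq K (derivative q) hq x, hP, Finset.sum_range_succ', derivative_add]
    simp [mPoly_zero, eval_finsetSum, derivative_mPoly_succ, hcoeff]
  have hends : P.eval 1 + P.eval (-1) = q.eval 1 + q.eval (-1) := by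
    rw [hP]
    simp only [eval_finsetSum, eval_mul, eval_C, ← Finset.sum_add_distrib, ← mul_add]
    rw [Finset.sum_range_succ']
    simp only [mPoly_eval_add_eval_neg_one, mul_zero, Finset.sum_const_zero, mPoly_zero, eval_one,
      mcoeff.eq_1]
    ring
  have hC := eq_C_of_natDegree_eq_zero (derivative_eq_zero.1
    (show derivative (P - q) = 0 by rw [derivative_sub, hderiv, sub_self]))
  set c := (P - q).coeff 0
  have hx : ∀ x, P.eval x - q.eval x = c := by
    intro x
    rw [← eval_sub, hC, eval_C]
  have h1 := hx 1
  have h2 := hx (-1)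
  have h3 := hx t
  rw [hPt]
  linarith

end MTypeFunctionals

section LegendreAverages

open Polynomial

/-- The reproducing kernel of polynomials of degree less than `K` on `[−1,1]`. -/
noncomputable def legendreKernel (K : ℕ) (x y : ℝ) : ℝ :=
  ∑ n ∈ Finset.range K, (2 * (n : ℝ) + 1) / 2 * (legendrePoly n).eval x * (legendrePoly n).eval y

/-- The `L²`-projection onto polynomials of degree less than `K`, evaluated at `x`. -/
noncomputable def legendreAvg (K : ℕ) (x : ℝ) (g : ℝ → ℝ) : ℝ :=
  ∫ y in (-1:ℝ)..1, g y * legendreKernel K x y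

theorem continuous_uncurry_legendreKernel (K : ℕ) :
    Continuous (Function.uncurry (legendreKernel K)) := by
  have h : Continuous fun p : ℝ × ℝ => legendreKernel K p.1 p.2 :=
    continuous_finsetSum _ fun n _ =>
      (continuous_const.mul ((legendrePoly n).continuous.comp continuous_fst)).mul
        ((legendrePoly n).continuous.comp continuous_snd)
  exact h

theorem continuous_legendreKernel (K : ℕ) (x : ℝ) : Continuous (legendreKernel K x) :=
  continuous_section_right (continuous_uncurry_legendreKernel K) x

theorem legendreAvg_sub (K : ℕ) (x : ℝ) {g h : ℝ → ℝ} (hg : Continuous g) (hh : Continuous h) :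
    legendreAvg K x (fun y => g y - h y) = legendreAvg K x g - legendreAvg K x h := by
  have := continuous_legendreKernel K x
  simp only [legendreAvg, sub_mul]
  rw [intervalIntegral.integral_sub]
  all_goals exact Continuous.intervalIntegrable (by fun_prop) _ _

theorem exists_eval_eq_legendreAvg (K : ℕ) {g : ℝ → ℝ} (hg : Continuous g) :
    ∃ p : ℝ[X], derivative^[K] p = 0 ∧ ∀ x, legendreAvg K x g = p.eval x := by
  refine ⟨∑ n ∈ Finset.range K, C ((2 * (n : ℝ) + 1) / 2 *
    ∫ y in (-1:ℝ)..1, g y * (legendrePoly n).eval y) * legendrePoly n, ?_, fun x => ?_⟩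
  · rw [iterate_derivative_sum]
    refine Finset.sum_eq_zero fun n hn => ?_
    rw [iterate_derivative_C_mul,
      iterate_derivative_legendrePoly_eq_zero (Finset.mem_range.1 hn), mul_zero]
  · simp only [legendreAvg, legendreKernel, Finset.mul_sum, eval_finsetSum, eval_mul, eval_C]
    rw [intervalIntegral.integral_finsetSum]
    · refine Finset.sum_congr rfl fun n _ => ?_
      rw [mul_right_comm, ← intervalIntegral.integral_const_mul]
      refine intervalIntegral.integral_congr fun y _ => ?_
      ring
    · intro n _
      exact Continuous.intervalIntegrable (by fun_prop) _ _

theorem legendreAvg_eval {K : ℕ} (q : ℝ[X]) (hq : derivative^[K] q = 0) (x : ℝ) :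
    legendreAvg K x (fun y => q.eval y) = q.eval x := by
  rw [← sum_legendrePoly_eq K q hq x]
  simp only [legendreAvg, legendreKernel, Finset.mul_sum]
  rw [intervalIntegral.integral_finsetSum]
  · refine Finset.sum_congr rfl fun n _ => ?_
    rw [mul_right_comm, ← intervalIntegral.integral_const_mul]
    refine intervalIntegral.integral_congr fun y _ => ?_
    ring
  · intro n _
    exact Continuous.intervalIntegrable (by fun_prop) _ _

theorem legendreAvg_const {K : ℕ} (hK : 0 < K) (x c : ℝ) : legendreAvg K x (fun _ => c) = c := by
  simpa using legendreAvg_eval (C c) (iterate_derivative_C hK) x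

theorem exists_abs_legendreAvg_le (K : ℕ) : ∃ W, 0 ≤ W ∧ ∀ x ∈ Set.Icc (-1:ℝ) 1, ∀ g : ℝ → ℝ,
    Continuous g → |legendreAvg K x g| ≤ W * ∫ y in (-1:ℝ)..1, |g y| := by
  obtain ⟨W, hW⟩ := (isCompact_Icc.prod isCompact_Icc).exists_bound_of_continuousOn
    (s := Set.Icc (-1:ℝ) 1 ×ˢ Set.Icc (-1:ℝ) 1) (continuous_uncurry_legendreKernel K).continuousOn
  refine ⟨W, (norm_nonneg _).trans (hW (0, 0) (by simp)), fun x hx g hg => ?_⟩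
  have hk := continuous_legendreKernel K x
  refine (intervalIntegral.abs_integral_le_integral_abs (by norm_num)).trans ?_
  rw [← intervalIntegral.integral_const_mul]
  refine intervalIntegral.integral_mono_on (by norm_num)
    (Continuous.intervalIntegrable (by fun_prop) _ _)
    (Continuous.intervalIntegrable (by fun_prop) _ _) fun y hy => ?_
  rw [abs_mul, mul_comm]
  exact mul_le_mul_of_nonneg_right (hW (x, y) ⟨hx, hy⟩) (abs_nonneg _)

theorem continuous_legendreAvg_comp {α : Type*} [TopologicalSpace α] [FirstCountableTopology α]
    (K : ℕ) {x : α → ℝ} (hx : Continuous x) {F : α → ℝ → ℝ}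
    (hF : Continuous (Function.uncurry F)) : Continuous fun a => legendreAvg K (x a) (F a) := by
  apply intervalIntegral.continuous_parametric_intervalIntegral_of_continuous'
  exact hF.mul ((continuous_uncurry_legendreKernel K).comp
    ((hx.comp continuous_fst).prodMk continuous_snd))

theorem continuous_legendreAvg {α : Type*} [TopologicalSpace α] [FirstCountableTopology α]
    (K : ℕ) (x : ℝ) {F : α → ℝ → ℝ} (hF : Continuous (Function.uncurry F)) :
    Continuous fun a => legendreAvg K x (F a) :=
  continuous_legendreAvg_comp K continuous_const hF

theorem legendreAvg_swap (K : ℕ) (x y : ℝ) {F : ℝ → ℝ → ℝ}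
    (hF : Continuous (Function.uncurry F)) :
    legendreAvg K x (fun u => legendreAvg K y (F u)) =
      legendreAvg K y (fun v => legendreAvg K x (fun u => F u v)) := by
  simp only [legendreAvg, ← intervalIntegral.integral_mul_const]
  rw [integral_swap_of_continuous]
  · refine intervalIntegral.integral_congr fun v _ => ?_
    refine intervalIntegral.integral_congr fun u _ => ?_
    ring
  · exact (hF.mul ((continuous_legendreKernel K y).comp continuous_snd)).mul
      ((continuous_legendreKernel K x).comp continuous_fst)

end LegendreAverages

section TaylorApproximation

open Polynomial

theorem exists_derivative_eq (p : ℝ[X]) : ∃ P : ℝ[X], derivative P = p := by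
  induction p using Polynomial.induction_on' with
  | add p q hp hq =>
    obtain ⟨P, rfl⟩ := hp
    obtain ⟨Q, rfl⟩ := hq
    exact ⟨P + Q, derivative_add⟩
  | monomial n a =>
    refine ⟨monomial (n + 1) (a / ((n : ℝ) + 1)), ?_⟩
    rw [derivative_monomial]
    congr 1
    push_cast
    field_simp

theorem abs_sub_le_integral_abs_deriv {g : ℝ → ℝ} (hg : ContDiff ℝ (⊤ : ℕ∞) g) {x : ℝ}
    (hx : x ∈ Set.Icc (-1:ℝ) 1) : |g x - g (-1)| ≤ ∫ y in (-1:ℝ)..1, |deriv g y| := by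
  have hc : Continuous (deriv g) := hg.continuous_deriv (by exact_mod_cast le_top)
  have hd : Differentiable ℝ g := hg.differentiable (by simp)
  rw [← intervalIntegral.integral_deriv_eq_sub (fun y _ => hd y) (hc.intervalIntegrable _ _)]
  refine (intervalIntegral.abs_integral_le_integral_abs hx.1).trans ?_
  exact intervalIntegral.integral_mono_interval le_rfl hx.1 hx.2
    (Filter.Eventually.of_forall fun _ => abs_nonneg _) (hc.abs.intervalIntegrable _ _)

/-- On `[−1,1]`, a smooth function is uniformly approximated by a polynomial of degree at most `m`
up to the `L¹` norm of its derivative of order `m + 1`. -/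
theorem exists_polynomial_abs_sub_le (m : ℕ) {g : ℝ → ℝ} (hg : ContDiff ℝ (⊤ : ℕ∞) g) :
    ∃ p : ℝ[X], p.natDegree ≤ m ∧ ∀ x ∈ Set.Icc (-1:ℝ) 1,
      |g x - p.eval x| ≤ 2 ^ m * ∫ y in (-1:ℝ)..1, |iteratedDeriv (m + 1) g y| := by
  induction m generalizing g with
  | zero =>
    refine ⟨C (g (-1)), by simp, fun x hx => ?_⟩
    simpa using abs_sub_le_integral_abs_deriv hg hx
  | succ m ih =>
    have hg' : ContDiff ℝ (⊤ : ℕ∞) (deriv g) := hg.deriv'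
    obtain ⟨p, hp, hbound⟩ := ih hg'
    obtain ⟨P, rfl⟩ := exists_derivative_eq p
    refine ⟨P + C (g (-1) - P.eval (-1)), ?_, fun x hx => ?_⟩
    · rw [natDegree_add_C]
      rw [natDegree_derivative] at hp
      omega
    · rw [iteratedDeriv_succ']
      set J := ∫ y in (-1:ℝ)..1, |iteratedDeriv (m + 1) (deriv g) y|
      have hP : ContDiff ℝ (⊤ : ℕ∞) (fun x => P.eval x) := by
        simpa using P.contDiff_aeval (𝕜 := ℝ) (⊤ : ℕ∞)
      have hd : Differentiable ℝ g := hg.differentiable (by simp)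
      have h := abs_sub_le_integral_abs_deriv (hg.sub hP) hx
      have hle : ∫ y in (-1:ℝ)..1, |deriv (fun x => g x - P.eval x) y| ≤ 2 * (2 ^ m * J) := by
        refine (le_abs_self _).trans (abs_integral_le_of_abs_le fun y hy => ?_)
        rw [abs_abs, deriv_fun_sub (hd y) P.differentiable.differentiableAt, Polynomial.deriv]
        exact hbound y hy
      rw [eval_add, eval_C, pow_succ]
      have e : g x - (P.eval x + (g (-1) - P.eval (-1))) =
        (g x - P.eval x) - (g (-1) - P.eval (-1)) := by ring
      rw [e]
      calc _ ≤ _ := h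
        _ ≤ _ := hle
        _ = _ := by ring

end TaylorApproximation

section Contraction

open Polynomial

theorem contract_mem_Icc {h s y : ℝ} (h0 : 0 ≤ h) (h1 : h ≤ 1) (hs : s ∈ Set.Icc (-1:ℝ) 1)
    (hy : y ∈ Set.Icc (-1:ℝ) 1) : h * y + (1 - h) * s ∈ Set.Icc (-1:ℝ) 1 :=
  (convex_Icc (-1:ℝ) 1) hy hs h0 (by linarith) (by ring)

/-- The change of a Legendre average under halving the interval towards `s` is controlled by the
`L¹` norm of the derivative of order `m + 1`. -/
theorem exists_abs_legendreAvg_half_sub_le (m : ℕ) : ∃ C, 0 ≤ C ∧ ∀ s ∈ Set.Icc (-1:ℝ) 1,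
    ∀ g : ℝ → ℝ, ContDiff ℝ (⊤ : ℕ∞) g →
      |legendreAvg (m + 1) s (fun y => g (1 / 2 * y + (1 - 1 / 2) * s)) - legendreAvg (m + 1) s g|
        ≤ C * ∫ y in (-1:ℝ)..1, |iteratedDeriv (m + 1) g y| := by
  obtain ⟨W, hW0, hW⟩ := exists_abs_legendreAvg_le (m + 1)
  refine ⟨4 * W * 2 ^ m, by positivity, fun s hs g hg => ?_⟩
  obtain ⟨p, hp, hbound⟩ := exists_polynomial_abs_sub_le m hg
  set J := ∫ y in (-1:ℝ)..1, |iteratedDeriv (m + 1) g y|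
  have hgc := hg.continuous
  set q : ℝ[X] := p.comp (C (1 / 2) * X + C ((1 - 1 / 2) * s)) with hqdef
  have hq : ∀ y, q.eval y = p.eval (1 / 2 * y + (1 - 1 / 2) * s) := by
    intro y
    simp [hqdef]
  have hqdeg : q.natDegree < m + 1 := by
    refine Nat.lt_succ_of_le (natDegree_comp_le.trans ?_)
    refine (Nat.mul_le_mul hp natDegree_linear_le).trans (by simp)
  have e1 : legendreAvg (m + 1) s (fun y => p.eval y) = p.eval s :=
    legendreAvg_eval p (iterate_derivative_eq_zero (Nat.lt_succ_of_le hp)) s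
  have e2 : legendreAvg (m + 1) s (fun y => q.eval y) = p.eval s := by
    rw [legendreAvg_eval q (iterate_derivative_eq_zero hqdeg) s, hq]
    congr 1
    ring
  have hpc := p.continuous
  have bound : ∀ r : ℝ → ℝ, Continuous r → (∀ y ∈ Set.Icc (-1:ℝ) 1, |r y| ≤ 2 ^ m * J) →
      |legendreAvg (m + 1) s r| ≤ W * (2 * (2 ^ m * J)) := by
    intro r hr hrb
    refine (hW s hs r hr).trans (mul_le_mul_of_nonneg_left ?_ hW0)
    refine (le_abs_self _).trans (abs_integral_le_of_abs_le fun y hy => ?_)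
    rw [abs_abs]
    exact hrb y hy
  have b1 := bound (fun y => g y - p.eval y) (by fun_prop) hbound
  have b2 := bound (fun y => g (1 / 2 * y + (1 - 1 / 2) * s) - q.eval y) (by fun_prop)
    (fun y hy => by
      rw [hq]
      exact hbound _ (contract_mem_Icc (by norm_num) (by norm_num) hs hy))
  rw [legendreAvg_sub _ _ hgc hpc, e1] at b1
  rw [legendreAvg_sub _ _ (by fun_prop) q.continuous, e2] at b2
  rw [abs_le] at b1 b2 ⊢
  constructor <;> linarith

theorem integral_comp_contract_le {φ : ℝ → ℝ} (hφ : Continuous φ) (h0 : ∀ x, 0 ≤ φ x) {h s : ℝ}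
    (hh : 0 < h) (hh1 : h ≤ 1) (hs : s ∈ Set.Icc (-1:ℝ) 1) :
    ∫ y in (-1:ℝ)..1, φ (h * y + (1 - h) * s) ≤ h⁻¹ * ∫ y in (-1:ℝ)..1, φ y := by
  rw [intervalIntegral.integral_comp_mul_add _ hh.ne', smul_eq_mul]
  refine mul_le_mul_of_nonneg_left ?_ (by positivity)
  exact intervalIntegral.integral_mono_interval
    (contract_mem_Icc hh.le hh1 hs (by norm_num)).1 (by linarith)
    (contract_mem_Icc hh.le hh1 hs (by norm_num)).2 (Filter.Eventually.of_forall h0)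
    (hφ.intervalIntegrable _ _)

theorem continuous_integral_right {F : ℝ → ℝ → ℝ} (hF : Continuous (Function.uncurry F)) :
    Continuous fun y => ∫ z in (-1:ℝ)..1, F y z :=
  intervalIntegral.continuous_parametric_intervalIntegral_of_continuous' hF _ _

theorem integral_integral_comp_contract_le {φ : ℝ → ℝ → ℝ}
    (hφ : Continuous (Function.uncurry φ)) (h0 : ∀ x y, 0 ≤ φ x y) {h s t : ℝ}
    (hh : 0 < h) (hh1 : h ≤ 1) (hs : s ∈ Set.Icc (-1:ℝ) 1) (ht : t ∈ Set.Icc (-1:ℝ) 1) :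
    ∫ y in (-1:ℝ)..1, ∫ z in (-1:ℝ)..1, φ (h * y + (1 - h) * s) (h * z + (1 - h) * t)
      ≤ h⁻¹ ^ 2 * ∫ y in (-1:ℝ)..1, ∫ z in (-1:ℝ)..1, φ y z := by
  have hΦ := continuous_integral_right hφ
  have hΨ : Continuous fun y => ∫ z in (-1:ℝ)..1,
      φ (h * y + (1 - h) * s) (h * z + (1 - h) * t) := by
    apply continuous_integral_right
    exact hφ.comp (f := fun p : ℝ × ℝ => (h * p.1 + (1 - h) * s, h * p.2 + (1 - h) * t))
      (by fun_prop)
  calc _ ≤ ∫ y in (-1:ℝ)..1, h⁻¹ * ∫ z in (-1:ℝ)..1, φ (h * y + (1 - h) * s) z := by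
        refine intervalIntegral.integral_mono_on (by norm_num) (hΨ.intervalIntegrable _ _)
          (Continuous.intervalIntegrable (by fun_prop) _ _) fun y _ => ?_
        exact integral_comp_contract_le (continuous_section_right hφ _) (h0 _) hh hh1 ht
    _ ≤ h⁻¹ * (h⁻¹ * ∫ y in (-1:ℝ)..1, ∫ z in (-1:ℝ)..1, φ y z) := by
        rw [intervalIntegral.integral_const_mul]
        refine mul_le_mul_of_nonneg_left ?_ (by positivity)
        exact integral_comp_contract_le hΦ
          (fun y => intervalIntegral.integral_nonneg (by norm_num) fun z _ => h0 y z) hh hh1 hs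
    _ = _ := by ring

theorem iteratedDeriv_comp_contract (m : ℕ) {g : ℝ → ℝ} (hg : ContDiff ℝ (⊤ : ℕ∞) g) (h c : ℝ) :
    iteratedDeriv m (fun z => g (h * z + c)) = fun z => h ^ m * iteratedDeriv m g (h * z + c) := by
  induction m generalizing g with
  | zero => simp
  | succ m ih =>
    have hd : Differentiable ℝ g := hg.differentiable (by simp)
    have e : deriv (fun z => g (h * z + c)) = fun z => h * deriv g (h * z + c) := by
      funext z
      have h1 : HasDerivAt (fun z => h * z + c) h z := by
        simpa using ((hasDerivAt_id z).const_mul h).add_const c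
      rw [mul_comm]
      exact ((hd (h * z + c)).hasDerivAt.comp z h1).deriv
    rw [iteratedDeriv_succ', e]
    have hg' : ContDiff ℝ (⊤ : ℕ∞) (deriv g) := hg.deriv'
    have hc : ContDiff ℝ (⊤ : ℕ∞) (fun z => deriv g (h * z + c)) :=
      hg'.comp ((contDiff_const.mul contDiff_id).add contDiff_const)
    funext z
    rw [iteratedDeriv_const_mul_field, ih hg', iteratedDeriv_succ', pow_succ']
    ring

end Contraction

section PointEvaluation

theorem contDiff_iteratedDeriv_left {f : ℝ → ℝ → ℝ}
    (hf : ContDiff ℝ (⊤ : ℕ∞) (Function.uncurry f)) (m : ℕ) :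
    ContDiff ℝ (⊤ : ℕ∞) (Function.uncurry fun s t => iteratedDeriv m (fun x => f x t) s) :=
  contDiff_uncurry_swap (contDiff_iteratedDeriv_right (contDiff_uncurry_swap hf) m)

/-- The sum of the `L¹` norms on `[−1,1]²` of the two pure partial derivatives of order `m`. -/
noncomputable def derivL1 (m : ℕ) (f : ℝ → ℝ → ℝ) : ℝ :=
  (∫ y in (-1:ℝ)..1, ∫ z in (-1:ℝ)..1, |iteratedDeriv m (fun x => f x z) y|) +
    ∫ y in (-1:ℝ)..1, ∫ z in (-1:ℝ)..1, |iteratedDeriv m (f y) z|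

theorem integral_integral_abs_nonneg (F : ℝ → ℝ → ℝ) :
    0 ≤ ∫ y in (-1:ℝ)..1, ∫ z in (-1:ℝ)..1, |F y z| :=
  intervalIntegral.integral_nonneg (by norm_num) fun _ _ =>
    intervalIntegral.integral_nonneg (by norm_num) fun _ _ => abs_nonneg _

/-- The change of a tensor product Legendre average under halving the square towards `(s, t)`. -/
theorem exists_abs_legendreAvg_legendreAvg_half_sub_le (m : ℕ) : ∃ C, 0 ≤ C ∧
    ∀ s ∈ Set.Icc (-1:ℝ) 1, ∀ t ∈ Set.Icc (-1:ℝ) 1, ∀ f : ℝ → ℝ → ℝ,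
      ContDiff ℝ (⊤ : ℕ∞) (Function.uncurry f) →
      |legendreAvg (m + 1) s (fun y => legendreAvg (m + 1) t
          (fun z => f (1 / 2 * y + (1 - 1 / 2) * s) (1 / 2 * z + (1 - 1 / 2) * t))) -
        legendreAvg (m + 1) s (fun y => legendreAvg (m + 1) t (f y))|
        ≤ C * derivL1 (m + 1) f := by
  obtain ⟨W, hW0, hW⟩ := exists_abs_legendreAvg_le (m + 1)
  obtain ⟨C, hC0, hC⟩ := exists_abs_legendreAvg_half_sub_le m
  refine ⟨2 * W * C, by positivity, fun s hs t ht f hf => ?_⟩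
  have hfc : Continuous fun p : ℝ × ℝ => f p.1 p.2 := hf.continuous
  have hA : Continuous fun y => legendreAvg (m + 1) t
      (fun z => f (1 / 2 * y + (1 - 1 / 2) * s) (1 / 2 * z + (1 - 1 / 2) * t)) :=
    continuous_legendreAvg _ _ (hfc.comp (f := fun p : ℝ × ℝ =>
      (1 / 2 * p.1 + (1 - 1 / 2) * s, 1 / 2 * p.2 + (1 - 1 / 2) * t)) (by fun_prop))
  have hBF : Continuous (Function.uncurry fun y => f (1 / 2 * y + (1 - 1 / 2) * s)) :=
    hfc.comp (f := fun p : ℝ × ℝ => (1 / 2 * p.1 + (1 - 1 / 2) * s, p.2)) (by fun_prop)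
  have hB := continuous_legendreAvg (m + 1) t hBF
  have hD := continuous_legendreAvg (m + 1) t hf.continuous
  have hB' := continuous_legendreAvg (m + 1) s (continuous_uncurry_swap hBF)
  have hD' := continuous_legendreAvg (m + 1) s (continuous_uncurry_swap hf.continuous)
  have hφ : Continuous fun y => ∫ z in (-1:ℝ)..1, |iteratedDeriv (m + 1) (f y) z| :=
    continuous_integral_right (contDiff_iteratedDeriv_right hf (m + 1)).continuous.abs
  have hψF : Continuous (Function.uncurry fun y z => |iteratedDeriv (m + 1) (fun x => f x z) y|) :=
    (contDiff_iteratedDeriv_left hf (m + 1)).continuous.abs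
  have hψ : Continuous fun z => ∫ y in (-1:ℝ)..1, |iteratedDeriv (m + 1) (fun x => f x z) y| :=
    continuous_integral_right (continuous_uncurry_swap hψF)
  have b1 := hW s hs _ (hA.sub hB)
  have b1' : (∫ y in (-1:ℝ)..1, |legendreAvg (m + 1) t
      (fun z => f (1 / 2 * y + (1 - 1 / 2) * s) (1 / 2 * z + (1 - 1 / 2) * t)) -
      legendreAvg (m + 1) t (f (1 / 2 * y + (1 - 1 / 2) * s))|) ≤
      C * ((1 / 2)⁻¹ * ∫ y in (-1:ℝ)..1, ∫ z in (-1:ℝ)..1, |iteratedDeriv (m + 1) (f y) z|) := by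
    refine le_trans ?_ (mul_le_mul_of_nonneg_left (integral_comp_contract_le hφ
      (fun y => intervalIntegral.integral_nonneg (by norm_num) fun _ _ => abs_nonneg _)
      (by norm_num : (0:ℝ) < 1 / 2) (by norm_num) hs) hC0)
    rw [← intervalIntegral.integral_const_mul]
    exact intervalIntegral.integral_mono_on (by norm_num)
      ((hA.sub hB).abs.intervalIntegrable _ _)
      ((continuous_const.mul (hφ.comp (by fun_prop))).intervalIntegrable _ _)
      fun y _ => hC t ht _ (contDiff_section_right hf _)
  have b2 := hW t ht _ (hB'.sub hD')
  have b2' : (∫ z in (-1:ℝ)..1, |legendreAvg (m + 1) s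
      (fun y => f (1 / 2 * y + (1 - 1 / 2) * s) z) - legendreAvg (m + 1) s (fun y => f y z)|) ≤
      C * ∫ y in (-1:ℝ)..1, ∫ z in (-1:ℝ)..1, |iteratedDeriv (m + 1) (fun x => f x z) y| := by
    rw [integral_swap_of_continuous hψF, ← intervalIntegral.integral_const_mul]
    exact intervalIntegral.integral_mono_on (by norm_num)
      ((hB'.sub hD').abs.intervalIntegrable _ _)
      (Continuous.intervalIntegrable (by fun_prop) _ _)
      fun z _ => hC s hs _ (contDiff_section_left hf _)
  have e1 := legendreAvg_sub (m + 1) s hA hB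
  have e2 := legendreAvg_sub (m + 1) t hB' hD'
  have s1 := legendreAvg_swap (m + 1) s t hBF
  have s2 := legendreAvg_swap (m + 1) s t hf.continuous
  have r1 := (e1 ▸ b1).trans (mul_le_mul_of_nonneg_left b1' hW0)
  have r2 := (e2 ▸ b2).trans (mul_le_mul_of_nonneg_left b2' hW0)
  have hJ := mul_nonneg (mul_nonneg hW0 hC0)
    (integral_integral_abs_nonneg fun y z => iteratedDeriv (m + 1) (fun x => f x z) y)
  rw [abs_le] at r1 r2 ⊢
  rw [derivL1]
  constructor <;> linarith

theorem derivL1_comp_contract_le {m : ℕ} (hm : 3 ≤ m) {f : ℝ → ℝ → ℝ}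
    (hf : ContDiff ℝ (⊤ : ℕ∞) (Function.uncurry f)) {h s t : ℝ} (hh : 0 < h) (hh1 : h ≤ 1)
    (hs : s ∈ Set.Icc (-1:ℝ) 1) (ht : t ∈ Set.Icc (-1:ℝ) 1) :
    derivL1 m (fun y z => f (h * y + (1 - h) * s) (h * z + (1 - h) * t)) ≤ h * derivL1 m f := by
  have key : ∀ φ : ℝ → ℝ → ℝ, Continuous (Function.uncurry φ) →
      ∫ y in (-1:ℝ)..1, ∫ z in (-1:ℝ)..1,
        |h ^ m * φ (h * y + (1 - h) * s) (h * z + (1 - h) * t)| ≤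
      h * ∫ y in (-1:ℝ)..1, ∫ z in (-1:ℝ)..1, |φ y z| := by
    intro φ hφ
    simp only [abs_mul, abs_of_pos (pow_pos hh m), intervalIntegral.integral_const_mul]
    have := integral_integral_comp_contract_le (φ := fun y z => |φ y z|) hφ.abs
      (fun y z => abs_nonneg (φ y z)) hh hh1 hs ht
    refine (mul_le_mul_of_nonneg_left this (by positivity)).trans ?_
    rw [← mul_assoc]
    refine mul_le_mul_of_nonneg_right ?_ (integral_integral_abs_nonneg φ)
    calc h ^ m * h⁻¹ ^ 2 ≤ h ^ 3 * h⁻¹ ^ 2 :=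
          mul_le_mul_of_nonneg_right (pow_le_pow_of_le_one hh.le hh1 hm) (by positivity)
      _ = h := by field_simp
  have k1 := key _ (contDiff_iteratedDeriv_left hf m).continuous
  have k2 := key _ (contDiff_iteratedDeriv_right hf m).continuous
  simp only [derivL1, mul_add,
    iteratedDeriv_comp_contract m (contDiff_section_right hf _) h,
    fun z => iteratedDeriv_comp_contract m (contDiff_section_left hf z) h]
  exact add_le_add k1 k2

/-- Comparison of the point value `f s t` with the tensor product Legendre average. -/
theorem exists_abs_sub_legendreAvg_legendreAvg_le {m : ℕ} (hm : 2 ≤ m) : ∃ C, 0 ≤ C ∧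
    ∀ s ∈ Set.Icc (-1:ℝ) 1, ∀ t ∈ Set.Icc (-1:ℝ) 1, ∀ f : ℝ → ℝ → ℝ,
      ContDiff ℝ (⊤ : ℕ∞) (Function.uncurry f) →
      |f s t - legendreAvg (m + 1) s (fun y => legendreAvg (m + 1) t (f y))|
        ≤ C * derivL1 (m + 1) f := by
  obtain ⟨C, hC0, hC⟩ := exists_abs_legendreAvg_legendreAvg_half_sub_le m
  refine ⟨2 * C, by positivity, fun s hs t ht f hf => ?_⟩
  have hfc : Continuous fun p : ℝ × ℝ => f p.1 p.2 := hf.continuous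
  set L : ℝ → ℝ := fun h => legendreAvg (m + 1) s (fun y => legendreAvg (m + 1) t
    (fun z => f (h * y + (1 - h) * s) (h * z + (1 - h) * t))) with hL
  have hLc : Continuous L := by
    have h1 : Continuous fun p : ℝ × ℝ => legendreAvg (m + 1) t
        (fun z => f (p.1 * p.2 + (1 - p.1) * s) (p.1 * z + (1 - p.1) * t)) :=
      continuous_legendreAvg _ _ (hfc.comp (f := fun q : (ℝ × ℝ) × ℝ =>
        (q.1.1 * q.1.2 + (1 - q.1.1) * s, q.1.1 * q.2 + (1 - q.1.1) * t)) (by fun_prop))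
    exact continuous_legendreAvg _ _ h1
  have hL0 : L 0 = f s t := by
    simp [hL, legendreAvg_const]
  have hL1 : L 1 = legendreAvg (m + 1) s (fun y => legendreAvg (m + 1) t (f y)) := by
    simp [hL]
  have hlim : Filter.Tendsto (fun n : ℕ => L ((1 / 2) ^ n)) Filter.atTop (nhds (L 0)) :=
    (hLc.tendsto 0).comp (tendsto_pow_atTop_nhds_zero_of_lt_one (by norm_num) (by norm_num))
  have hstep : ∀ n : ℕ, dist (L ((1 / 2) ^ n)) (L ((1 / 2) ^ (n + 1))) ≤
      2 * C * derivL1 (m + 1) f / 2 / 2 ^ n := by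
    intro n
    have hn : (0:ℝ) < (1 / 2) ^ n := by positivity
    have hn1 : ((1:ℝ) / 2) ^ n ≤ 1 := pow_le_one₀ (by norm_num) (by norm_num)
    have hfn : ContDiff ℝ (⊤ : ℕ∞) (Function.uncurry fun y z =>
        f ((1 / 2) ^ n * y + (1 - (1 / 2) ^ n) * s) ((1 / 2) ^ n * z + (1 - (1 / 2) ^ n) * t)) :=
      hf.comp (f := fun p : ℝ × ℝ => ((1 / 2) ^ n * p.1 + (1 - (1 / 2) ^ n) * s,
        (1 / 2) ^ n * p.2 + (1 - (1 / 2) ^ n) * t)) (by fun_prop)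
    have h1 := (hC s hs t ht _ hfn).trans (mul_le_mul_of_nonneg_left
      (derivL1_comp_contract_le (by omega) hf hn hn1 hs ht) hC0)
    have e : ∀ u y : ℝ, ((1:ℝ) / 2) ^ n * (1 / 2 * y + (1 - 1 / 2) * u) +
        (1 - (1 / 2) ^ n) * u = (1 / 2) ^ (n + 1) * y + (1 - (1 / 2) ^ (n + 1)) * u := by
      intro u y
      ring
    simp only [e] at h1
    rw [dist_comm, Real.dist_eq]
    refine h1.trans (le_of_eq ?_)
    rw [one_div, inv_pow]
    field_simp
  have := dist_le_of_le_geometric_two_of_tendsto₀ hstep hlim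
  rwa [pow_zero, hL0, hL1, dist_comm, Real.dist_eq] at this

theorem sq_integral_le {φ : ℝ → ℝ} (hφ : Continuous φ) :
    (∫ y in (-1:ℝ)..1, φ y) ^ 2 ≤ 2 * ∫ y in (-1:ℝ)..1, φ y ^ 2 := by
  set I := ∫ y in (-1:ℝ)..1, φ y with hI
  have h : 0 ≤ ∫ y in (-1:ℝ)..1, (φ y - I / 2) ^ 2 :=
    intervalIntegral.integral_nonneg (by norm_num) fun _ _ => sq_nonneg _
  have e : ∀ y, (φ y - I / 2) ^ 2 = φ y ^ 2 - I * φ y + I ^ 2 / 4 := fun y => by ring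
  simp only [e] at h
  rw [intervalIntegral.integral_add, intervalIntegral.integral_sub,
    intervalIntegral.integral_const_mul, ← hI, intervalIntegral.integral_const, smul_eq_mul] at h
  · linarith
  all_goals exact Continuous.intervalIntegrable (by fun_prop) _ _

theorem integral_integral_abs_le_sqrt {F : ℝ → ℝ → ℝ} (hF : Continuous (Function.uncurry F)) :
    ∫ y in (-1:ℝ)..1, ∫ z in (-1:ℝ)..1, |F y z| ≤
      2 * √(∫ y in (-1:ℝ)..1, ∫ z in (-1:ℝ)..1, F y z ^ 2) := by
  have hφ : Continuous fun y => ∫ z in (-1:ℝ)..1, |F y z| := continuous_integral_right hF.abs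
  have hφ2 : Continuous fun y => ∫ z in (-1:ℝ)..1, F y z ^ 2 :=
    continuous_integral_right (hF.pow 2)
  have h2 : ∫ y in (-1:ℝ)..1, (∫ z in (-1:ℝ)..1, |F y z|) ^ 2 ≤
      2 * ∫ y in (-1:ℝ)..1, ∫ z in (-1:ℝ)..1, F y z ^ 2 := by
    rw [← intervalIntegral.integral_const_mul]
    refine intervalIntegral.integral_mono_on (by norm_num)
      (Continuous.intervalIntegrable (by fun_prop) _ _)
      (Continuous.intervalIntegrable (by fun_prop) _ _) fun y _ => ?_
    simpa using sq_integral_le (continuous_section_right hF y).abs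
  have h := (sq_integral_le hφ).trans (mul_le_mul_of_nonneg_left h2 zero_le_two)
  refine (Real.le_sqrt_of_sq_le h).trans (le_of_eq ?_)
  rw [← mul_assoc, Real.sqrt_mul (by norm_num), show (2:ℝ) * 2 = 2 ^ 2 by norm_num,
    Real.sqrt_sq zero_le_two]

theorem derivL1_le_seminorm2 (m : ℕ) {f : ℝ → ℝ → ℝ}
    (hf : ContDiff ℝ (⊤ : ℕ∞) (Function.uncurry f)) : derivL1 m f ≤ 4 * seminorm2 m f := by
  have h1 := integral_integral_abs_le_sqrt (contDiff_iteratedDeriv_left hf m).continuous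
  have h2 := integral_integral_abs_le_sqrt (contDiff_iteratedDeriv_right hf m).continuous
  have nn : ∀ F : ℝ → ℝ → ℝ, 0 ≤ ∫ y in (-1:ℝ)..1, ∫ z in (-1:ℝ)..1, F y z ^ 2 := fun F =>
    intervalIntegral.integral_nonneg (by norm_num) fun _ _ =>
      intervalIntegral.integral_nonneg (by norm_num) fun _ _ => sq_nonneg _
  have s1 := Real.sqrt_le_sqrt (le_add_of_nonneg_right
    (a := ∫ y in (-1:ℝ)..1, ∫ z in (-1:ℝ)..1, iteratedDeriv m (fun x => f x z) y ^ 2)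
    (nn fun y z => iteratedDeriv m (f y) z))
  have s2 := Real.sqrt_le_sqrt (le_add_of_nonneg_left
    (a := ∫ y in (-1:ℝ)..1, ∫ z in (-1:ℝ)..1, iteratedDeriv m (f y) z ^ 2)
    (nn fun y z => iteratedDeriv m (fun x => f x z) y))
  simp only [derivL1, seminorm2, pderiv2, iteratedDeriv_zero]
  linarith

end PointEvaluation

/-- The M-type projection reproduces the tensor product Legendre projection. -/
theorem mproj_mproj_legendreAvg {K : ℕ} {f : ℝ → ℝ → ℝ} (hf : Continuous (Function.uncurry f))
    (s t : ℝ) :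
    mproj (K + 1) s (fun x => mproj (K + 1) t
      (fun y => legendreAvg (K + 1) x (fun u => legendreAvg (K + 1) y (f u)))) =
      legendreAvg (K + 1) s (fun u => legendreAvg (K + 1) t (f u)) := by
  have hl := continuous_legendreAvg (K + 1) t hf
  have hr : ∀ x, Continuous fun v => legendreAvg (K + 1) x (fun u => f u v) := fun x =>
    continuous_legendreAvg (K + 1) x (continuous_uncurry_swap hf)
  have inner : ∀ x, mproj (K + 1) t
      (fun y => legendreAvg (K + 1) x (fun u => legendreAvg (K + 1) y (f u))) =
      legendreAvg (K + 1) x (fun u => legendreAvg (K + 1) t (f u)) := by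
    intro x
    obtain ⟨p, hp, hpe⟩ := exists_eval_eq_legendreAvg (K + 1) (hr x)
    simp only [legendreAvg_swap (K + 1) x _ hf, hpe]
    exact mproj_eval p hp t
  obtain ⟨p, hp, hpe⟩ := exists_eval_eq_legendreAvg (K + 1) hl
  simp only [inner, hpe]
  exact mproj_eval p hp s

/-- For every `k ≥ 2` there is a constant `C_k` such that for every smooth
`f` on `K̂ = [−1,1]²`, `sup_{(s,t) ∈ K̂} |f(s,t) − f_{k,k}(s,t)| ≤ C_k [f]_{k+1}`. -/
theorem mproj2_remainder_sup_bound (k : ℕ) (hk : 2 ≤ k) :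
    ∃ C : ℝ, 0 < C ∧ ∀ f : ℝ → ℝ → ℝ, ContDiff ℝ (⊤ : ℕ∞) (Function.uncurry f) →
      ∀ s ∈ Set.Icc (-1:ℝ) 1, ∀ t ∈ Set.Icc (-1:ℝ) 1,
        |f s t - mproj2 f k s t| ≤ C * seminorm2 (k + 1) f := by
  obtain ⟨A, hA0, hA⟩ := exists_abs_sub_legendreAvg_legendreAvg_le hk
  obtain ⟨P, hP0, hP⟩ := exists_abs_mproj_le (k + 1)
  refine ⟨(1 + P * P) * (A * 4) + 1, by positivity, fun f hf s hs t ht => ?_⟩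
  set b := A * (4 * seminorm2 (k + 1) f) with hb
  set q : ℝ → ℝ → ℝ := fun x y =>
    legendreAvg (k + 1) x (fun u => legendreAvg (k + 1) y (f u)) with hq
  have hfq : ∀ x ∈ Set.Icc (-1:ℝ) 1, ∀ y ∈ Set.Icc (-1:ℝ) 1, |f x y - q x y| ≤ b :=
    fun x hx y hy => (hA x hx y hy f hf).trans
      (mul_le_mul_of_nonneg_left (derivL1_le_seminorm2 _ hf) hA0)
  have hqc : Continuous (Function.uncurry q) := by
    have h1 : Continuous fun r : (ℝ × ℝ) × ℝ => legendreAvg (k + 1) r.1.2 (f r.2) :=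
      continuous_legendreAvg_comp _ (by fun_prop)
        (hf.continuous.comp ((continuous_snd.comp continuous_fst).prodMk continuous_snd))
    exact continuous_legendreAvg_comp (k + 1) continuous_fst h1
  have e : mproj (k + 1) s (fun x => mproj (k + 1) t fun y => f x y - q x y) =
      mproj2 f k s t - q s t := by
    simp only [mproj_sub _ _ (continuous_section_right hf.continuous _)
      (continuous_section_right hqc _)]
    rw [mproj_sub _ _ (continuous_mproj _ _ hf.continuous) (continuous_mproj _ _ hqc),
      mproj2_eq_mproj_mproj hf, mproj_mproj_legendreAvg hf.continuous]
  have h1 := hfq s hs t ht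
  have h2 := hP s hs (fun x => mproj (k + 1) t fun y => f x y - q x y) (P * b)
    fun x hx => hP t ht _ b (hfq x hx)
  rw [e] at h2
  have hn : 0 ≤ seminorm2 (k + 1) f := Real.sqrt_nonneg _
  have h3 : |f s t - mproj2 f k s t| ≤ (1 + P * P) * b := by
    rw [abs_le] at h1 h2 ⊢
    constructor <;> linarith
  refine h3.trans ?_
  rw [hb]
  linarith
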